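/- Let a : ℕ → ℝ satisfy a(0) = 1 and the Hecke recursion a(1)·a(r) = a(r+1) + a(r−1) for every integer r ≥ 1. Then for every integer m ≥ 0, a(1)^{2m+1} = Σ_{r=0}^{m} ( C(2m+1, m−r) − C(2m+1, m−r−1) ) · a(2r+1), where C(n,j) denotes the binomial coefficient, with the convention C(n,j) = 0 when j < 0. -/

import Mathlib

/-- Binomial coefficient with an integer lower argument, with the convention that it
vanishes for negative lower argument. -/
noncomputable def binomInt (n : ℕ) (j : ℤ) : ℝ :=
  if 0 ≤ j then (n.choose j.toNat : ℝ) else 0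

theorem binomInt_pascal (n : ℕ) (j : ℤ) :
    binomInt (n + 1) j = binomInt n j + binomInt n (j - 1) := by
  unfold binomInt
  rcases lt_trichotomy j 0 with h | h | h
  · rw [if_neg (by omega), if_neg (by omega), if_neg (by omega)]; simp
  · subst h; simp
  · obtain ⟨k, rfl⟩ : ∃ k : ℕ, j = k + 1 := ⟨(j - 1).toNat, by omega⟩
    rw [if_pos (by omega), if_pos (by omega), if_pos (by omega)]
    have h1 : ((k : ℤ) + 1).toNat = k + 1 := by omega
    have h2 : ((k : ℤ) + 1 - 1).toNat = k := by omega
    rw [h1, h2, Nat.choose_succ_succ]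
    push_cast
    ring

noncomputable def heckeCoef (m : ℕ) (r : ℤ) : ℝ :=
  binomInt (2 * m + 1) ((m : ℤ) - r) - binomInt (2 * m + 1) ((m : ℤ) - r - 1)

theorem heckeCoef_succ (m : ℕ) (r : ℤ) :
    heckeCoef (m + 1) r = heckeCoef m (r - 1) + 2 * heckeCoef m r + heckeCoef m (r + 1) := by
  unfold heckeCoef
  have e : 2 * (m + 1) + 1 = (2 * m + 1) + 1 + 1 := by ring
  rw [e]
  simp only [binomInt_pascal (2 * m + 1 + 1), binomInt_pascal (2 * m + 1)]
  have e0 : ((m + 1 : ℕ) : ℤ) - r = (m : ℤ) - r + 1 := by push_cast; ring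
  have e1 : (m : ℤ) - (r - 1) = (m : ℤ) - r + 1 := by ring
  have e2 : (m : ℤ) - (r + 1) = (m : ℤ) - r - 1 := by ring
  rw [e0, e1, e2]
  simp only [add_sub_cancel_right]
  ring

theorem heckeCoef_neg_one (m : ℕ) : heckeCoef m (-1) = 0 := by
  unfold heckeCoef binomInt
  rw [if_pos (by omega), if_pos (by omega)]
  have h1 : ((m : ℤ) - -1).toNat = m + 1 := by omega
  have h2 : ((m : ℤ) - -1 - 1).toNat = m := by omega
  rw [h1, h2, Nat.choose_symm_half, sub_self]

theorem heckeCoef_big (m : ℕ) (r : ℤ) (h : (m : ℤ) < r) : heckeCoef m r = 0 := by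
  unfold heckeCoef binomInt
  rw [if_neg (by omega), if_neg (by omega), sub_self]

theorem hecke_sum_step (a : ℕ → ℝ) (h0 : a 0 = 1)
    (hrec : ∀ r : ℕ, 1 ≤ r → a 1 * a r = a (r + 1) + a (r - 1)) (m N : ℕ) :
    ∑ r ∈ Finset.range (N + 1), heckeCoef (m + 1) r * a (2 * r + 1) =
      a 1 ^ 2 * ∑ r ∈ Finset.range (N + 1), heckeCoef m r * a (2 * r + 1)
        - heckeCoef m N * a (2 * N + 3) + heckeCoef m (N + 1) * a (2 * N + 1) := by
  have h1 := hrec 1 le_rfl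
  have h2 := hrec 2 (by norm_num)
  norm_num at h1 h2
  induction N with
  | zero =>
    have hc := heckeCoef_succ m 0
    have hn := heckeCoef_neg_one m
    norm_num at hc
    simp only [zero_add, Finset.sum_range_one, Nat.cast_zero, mul_zero]
    rw [hc, hn]
    linear_combination (-heckeCoef m 0) * (a 1 * h1 + h2) - heckeCoef m 0 * a 1 * h0
  | succ N ih =>
    rw [Finset.sum_range_succ, ih, Finset.sum_range_succ _ (N + 1), heckeCoef_succ]
    have g1 := hrec (2 * N + 2) (by omega)
    have g2 := hrec (2 * N + 3) (by omega)
    have g3 := hrec (2 * N + 4) (by omega)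
    have e1 : 2 * N + 2 - 1 = 2 * N + 1 := by omega
    have e2 : 2 * N + 3 - 1 = 2 * N + 2 := by omega
    have e3 : 2 * N + 4 - 1 = 2 * N + 3 := by omega
    rw [e1] at g1
    rw [e2] at g2
    rw [e3] at g3
    have f1 : 2 * (N + 1) + 1 = 2 * N + 3 := by ring
    have f2 : 2 * (N + 1) + 3 = 2 * N + 5 := by ring
    rw [f1, f2]
    push_cast
    rw [add_sub_cancel_right]
    linear_combination (-heckeCoef m (N + 1)) * (a 1 * g2 + g1 + g3)

/-- **Odd powers of a Hecke eigenvalue.**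
If `a : ℕ → ℝ` satisfies `a 0 = 1` and the Hecke recursion
`a 1 * a r = a (r+1) + a (r-1)` for `r ≥ 1`, then for every `m ≥ 0`,
`a(1)^{2m+1} = Σ_{r=0}^{m} (C(2m+1, m-r) - C(2m+1, m-r-1)) a(2r+1)`,
with the convention `C(n,j) = 0` for `j < 0`. -/
theorem pow_odd_eq_sum_hecke
    (a : ℕ → ℝ) (h0 : a 0 = 1)
    (hrec : ∀ r : ℕ, 1 ≤ r → a 1 * a r = a (r + 1) + a (r - 1)) (m : ℕ) :
    (a 1) ^ (2 * m + 1) =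
      ∑ r ∈ Finset.range (m + 1),
        (binomInt (2 * m + 1) ((m : ℤ) - r) - binomInt (2 * m + 1) ((m : ℤ) - r - 1)) *
          a (2 * r + 1) := by
  change _ = ∑ r ∈ Finset.range (m + 1), heckeCoef m r * a (2 * r + 1)
  induction m with
  | zero => simp [heckeCoef, binomInt]
  | succ m ih =>
    rw [hecke_sum_step a h0 hrec m (m + 1), Finset.sum_range_succ, ← ih,
      heckeCoef_big m _ (by push_cast; omega), heckeCoef_big m _ (by push_cast; omega)]
    ring
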